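/- arXiv:1703.01330 — 3 statements merged into one kernel-verified Lean document; each statement's English description precedes it below -/
import Mathlib

section
/- Let p be a positive integer, q a real number with p + q > 1, and t > 0. Then (1/2π) ∫_ℝ e^{itω} (1+iω)^{-p} (1-iω)^{-q} dω = 2^{1-(p+q)} e^{-t} · Σ_{k=0}^{p-1} (-1)^{p-1-k} C(-q, p-1-k) (2t)^k / k!, where C(u,j) = u(u-1)⋯(u-j+1)/j! is the generalized binomial coefficient (C(u,0)=1). -/
open Complex Real MeasureTheory Nat

/-- The generalized binomial coefficient `C(u,j) = u(u-1)⋯(u-j+1)/j!` for `u : ℝ`, `j : ℕ`. -/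
noncomputable def genBinom (u : ℝ) (j : ℕ) : ℝ :=
  (∏ i ∈ Finset.range j, (u - i)) / (j ! : ℝ)

theorem circleIntegral_div_sub_pow_succ {U : Set ℂ} (hU : IsOpen U) {c w : ℂ} {R : ℝ}
    (hR : Metric.closedBall c R ⊆ U) (hw : w ∈ Metric.ball c R) (n : ℕ) {f : ℂ → ℂ}
    (hf : DifferentiableOn ℂ f U) :
    ∮ z in C(c, R), f z / (z - w) ^ (n + 1) = 2 * π * I * iteratedDeriv n f w / (n ! : ℂ) := by
  have hR0 : 0 < R := Metric.pos_of_mem_ball hw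
  have hne : ∀ z ∈ Metric.sphere c R, z - w ≠ 0 := fun z hz h => by
    rw [sub_eq_zero.1 h] at hz
    exact (Metric.mem_ball.1 hw).ne hz
  have hsph : Metric.sphere c R ⊆ U := Metric.sphere_subset_closedBall.trans hR
  induction n generalizing f with
  | zero =>
    have h := (hf.mono hR).circleIntegral_sub_inv_smul hw
    simp only [smul_eq_mul] at h
    simp only [zero_add, pow_one, iteratedDeriv_zero, Nat.factorial_zero, Nat.cast_one, div_one,
      ← h]
    simp only [div_eq_inv_mul]
  | succ n ih =>
    have hf' : DifferentiableOn ℂ (deriv f) U := hf.deriv hU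
    have hcirc : ∀ g : ℂ → ℂ, DifferentiableOn ℂ g U → ∀ m : ℕ,
        CircleIntegrable (fun z => g z / (z - w) ^ m) c R := fun g hg m =>
      ContinuousOn.circleIntegrable hR0.le <|
        (hg.continuousOn.mono hsph).div (by fun_prop) fun z hz => pow_ne_zero _ (hne z hz)
    have key : ∮ z in C(c, R), (deriv f z / (z - w) ^ (n + 1) -
        (n + 1 : ℂ) * (f z / (z - w) ^ (n + 1 + 1))) = 0 := by
      refine circleIntegral.integral_eq_zero_of_hasDerivWithinAt
        (f := fun z => f z / (z - w) ^ (n + 1)) hR0.le fun z hz => ?_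
      have h0 := hne z hz
      have h1 : HasDerivAt f (deriv f z) z :=
        (hf.differentiableAt (hU.mem_nhds (hsph hz))).hasDerivAt
      have h2 : HasDerivAt (fun z => (z - w) ^ (n + 1)) ((n + 1 : ℂ) * (z - w) ^ n) z := by
        simpa using ((hasDerivAt_id' z).sub_const w).fun_pow (n + 1)
      refine ((h1.fun_div h2 (pow_ne_zero _ h0)).congr_deriv ?_).hasDerivWithinAt
      field_simp
      ring
    have hcirc' : CircleIntegrable (fun z => (n + 1 : ℂ) * (f z / (z - w) ^ (n + 1 + 1))) c R :=
      (hcirc f hf _).const_mul (n + 1 : ℂ)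
    rw [circleIntegral.integral_sub (hcirc _ hf' _) hcirc',
      circleIntegral.integral_const_mul, ih hf', ← iteratedDeriv_succ', sub_eq_zero] at key
    have hn : (n + 1 : ℂ) ≠ 0 := by exact_mod_cast n.succ_ne_zero
    have hn' : (n ! : ℂ) ≠ 0 := by exact_mod_cast n.factorial_ne_zero
    rw [Nat.factorial_succ]
    push_cast
    field_simp
    field_simp at key
    linear_combination -key

theorem iteratedDeriv_const_sub_cpow (a s : ℂ) (j : ℕ) {w : ℂ} (hw : w.re < a.re) :
    iteratedDeriv j (fun z => (a - z) ^ s) w =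
      (-1) ^ j * (∏ i ∈ Finset.range j, (s - i)) * (a - w) ^ (s - j) := by
  induction j generalizing w with
  | zero => simp
  | succ j ih =>
    have hev : iteratedDeriv j (fun z => (a - z) ^ s) =ᶠ[nhds w] fun z =>
        (-1) ^ j * (∏ i ∈ Finset.range j, (s - i)) * (a - z) ^ (s - j) := by
      filter_upwards [(isOpen_lt Complex.continuous_re continuous_const).mem_nhds hw] with z hz
        using ih hz
    rw [iteratedDeriv_succ, hev.deriv_eq]
    have hs : a - w ∈ Complex.slitPlane := Or.inl (by simpa using hw)
    have h := (((hasDerivAt_id' w).const_sub a).cpow_const (c := s - j) hs).const_mul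
      ((-1) ^ j * ∏ i ∈ Finset.range j, (s - i))
    rw [h.deriv, Finset.prod_range_succ]
    rw [show s - ↑(j + 1) = s - j - 1 by push_cast; ring]
    ring

theorem differentiableOn_exp_mul_const_sub_cpow (t a s : ℂ) :
    DifferentiableOn ℂ (fun z => Complex.exp (t * z) * (a - z) ^ s) {z | z.re < a.re} := by
  refine DifferentiableOn.mul (by fun_prop) ?_
  exact DifferentiableOn.cpow_const (by fun_prop) fun z hz => Or.inl (by simpa using hz)

theorem iteratedDeriv_exp_mul_const_sub_cpow (t a s : ℂ) (n : ℕ) (ha : 0 < a.re) :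
    iteratedDeriv n (fun z => Complex.exp (t * z) * (a - z) ^ s) 0 / (n ! : ℂ) =
      ∑ k ∈ Finset.range (n + 1), t ^ k / (k ! : ℂ) *
        ((-1) ^ (n - k) * (∏ i ∈ Finset.range (n - k), (s - i)) / ((n - k)! : ℂ) *
          a ^ (s - (n - k : ℕ))) := by
  have h2 : ContDiffAt ℂ n (fun z => (a - z) ^ s) 0 := by
    have hU : {z : ℂ | z.re < a.re} ∈ nhds (0 : ℂ) :=
      (isOpen_lt Complex.continuous_re continuous_const).mem_nhds (by simpa using ha)
    refine (DifferentiableOn.analyticAt (fun z hz => ?_) hU).contDiffAt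
    exact ((differentiableAt_id.const_sub a).cpow_const
      (Or.inl (by simpa using hz))).differentiableWithinAt
  rw [iteratedDeriv_fun_mul (by fun_prop) h2, Finset.sum_div]
  refine Finset.sum_congr rfl fun k hk => ?_
  have hk' : k ≤ n := by simpa [Nat.lt_succ_iff] using hk
  rw [iteratedDeriv_cexp_const_mul, iteratedDeriv_const_sub_cpow _ _ _ (by simpa using ha),
    Nat.cast_choose ℂ hk']
  have hn' : ∀ m : ℕ, (m ! : ℂ) ≠ 0 := fun m => by exact_mod_cast m.factorial_ne_zero
  have := hn' n
  have := hn' k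
  have := hn' (n - k)
  simp
  field_simp

theorem circleIntegral_eq_I_mul_integral_arcLength (F : ℂ → ℂ) (c : ℂ) {R : ℝ} (hR : 0 < R) :
    ∮ z in C(c, R), F z = I * ∫ u in (-(π * R))..(π * R),
      Complex.exp ((u / R : ℝ) * I) * F (circleMap c R (u / R)) := by
  have hper : Function.Periodic (fun θ : ℝ => deriv (circleMap c R) θ • F (circleMap c R θ))
      (2 * π) := fun θ => by
    simp only [deriv_circleMap, periodic_circleMap _ _ θ]
  have h := hper.intervalIntegral_add_eq 0 (-π)
  rw [zero_add, show -π + 2 * π = π by ring] at h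
  rw [circleIntegral, h, intervalIntegral.integral_comp_div
    (fun θ : ℝ => Complex.exp (θ * I) * F (circleMap c R θ)) hR.ne', ← neg_mul,
    mul_div_cancel_right₀ _ hR.ne', mul_div_cancel_right₀ _ hR.ne', Complex.real_smul,
    ← mul_assoc, ← intervalIntegral.integral_const_mul]
  refine intervalIntegral.integral_congr fun θ _ => ?_
  simp only [deriv_circleMap, circleMap, smul_eq_mul]
  ring

theorem norm_sq_circleMap_one_sub (R θ : ℝ) :
    ‖circleMap (1 - R) R θ‖ ^ 2 = 1 + 2 * R * (R - 1) * (1 - Real.cos θ) := by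
  have h := Real.sin_sq_add_cos_sq θ
  rw [← Complex.normSq_eq_norm_sq, Complex.normSq_apply]
  simp [circleMap, Complex.exp_ofReal_mul_I_re, Complex.exp_ofReal_mul_I_im]
  linear_combination R ^ 2 * h

theorem norm_sq_two_sub_circleMap_one_sub (R θ : ℝ) :
    ‖2 - circleMap (1 - R) R θ‖ ^ 2 = 1 + 2 * R * (R + 1) * (1 - Real.cos θ) := by
  have h := Real.sin_sq_add_cos_sq θ
  rw [← Complex.normSq_eq_norm_sq, Complex.normSq_apply]
  simp [circleMap, Complex.exp_ofReal_mul_I_re, Complex.exp_ofReal_mul_I_im]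
  linear_combination R ^ 2 * h

theorem re_circleMap_one_sub_le {R : ℝ} (hR : 0 ≤ R) (θ : ℝ) :
    (circleMap (1 - R) R θ).re ≤ 1 := by
  simp only [circleMap, Complex.add_re, Complex.sub_re, Complex.one_re, Complex.ofReal_re,
    Complex.re_ofReal_mul, Complex.exp_ofReal_mul_I_re]
  nlinarith [Real.cos_le_one θ]

theorem one_add_sq_div_five_le_norm_sq_circleMap {R u : ℝ} (hR : 2 ≤ R) (hu : |u| ≤ π * R) :
    (1 + u ^ 2) / 5 ≤ ‖circleMap (1 - R) R (u / R)‖ ^ 2 := by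
  have hR0 : 0 < R := by linarith
  have hθ : |u / R| ≤ π := by rwa [abs_div, abs_of_pos hR0, div_le_iff₀ hR0]
  have hc := Real.cos_le_one_sub_mul_cos_sq hθ
  have hpi : (1 : ℝ) / 5 ≤ 2 / π ^ 2 := by
    rw [div_le_div_iff₀ (by norm_num) (by positivity)]
    nlinarith [Real.pi_lt_d2, Real.pi_pos]
  have h1 : 1 / 5 * (u / R) ^ 2 ≤ 1 - Real.cos (u / R) := by
    nlinarith [mul_le_mul_of_nonneg_right hpi (sq_nonneg (u / R))]
  have h2 : R ^ 2 * (u / R) ^ 2 = u ^ 2 := by field_simp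
  rw [norm_sq_circleMap_one_sub]
  have h3 : R ^ 2 * (1 / 5 * (u / R) ^ 2) ≤ 2 * R * (R - 1) * (1 - Real.cos (u / R)) :=
    mul_le_mul (by nlinarith) h1 (by positivity) (by nlinarith)
  nlinarith

theorem rpow_neg_div_pow_le {A B m q : ℝ} {p : ℕ} (hm : 0 < m) (hA : 0 < A) (hmA : m ≤ A ^ 2)
    (hAB : A ≤ B) (hBA : B ≤ 3 * A) (hpq : 0 ≤ p + q) :
    B ^ (-q) / A ^ p ≤ 3 ^ |q| * m ^ (-(p + q) / 2) := by
  have hr1 : 1 ≤ B / A := by rwa [le_div_iff₀ hA, one_mul]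
  have hr3 : B / A ≤ 3 := by rwa [div_le_iff₀ hA]
  have h1 : (B / A) ^ (-q) ≤ 3 ^ |q| :=
    (Real.rpow_le_rpow_of_exponent_le hr1 (neg_le_abs q)).trans
      (Real.rpow_le_rpow (by linarith) hr3 (abs_nonneg q))
  have h2 : (A ^ 2) ^ (-(p + q) / 2) ≤ m ^ (-(p + q) / 2) :=
    Real.rpow_le_rpow_of_nonpos hm hmA (by linarith)
  have h3 : B ^ (-q) / A ^ p = (B / A) ^ (-q) * (A ^ 2) ^ (-(p + q) / 2) := by
    rw [Real.div_rpow (hA.le.trans hAB) hA.le, ← Real.rpow_natCast A 2, ← Real.rpow_mul hA.le,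
      ← Real.rpow_natCast A p, div_mul_eq_mul_div, div_eq_div_iff (by positivity) (by positivity),
      mul_assoc, ← Real.rpow_add hA]
    congr 2
    push_cast
    ring
  rw [h3]
  exact mul_le_mul h1 h2 (by positivity) (by positivity)

theorem norm_two_sub_cpow_div_pow_circleMap_le {R u q : ℝ} {p : ℕ} (hR : 2 ≤ R)
    (hu : |u| ≤ π * R) (hpq : 0 ≤ p + q) :
    ‖(2 - circleMap (1 - R) R (u / R)) ^ (-(q : ℂ)) / circleMap (1 - R) R (u / R) ^ p‖ ≤
      3 ^ |q| * ((1 + u ^ 2) / 5) ^ (-(p + q) / 2) := by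
  have hm := one_add_sq_div_five_le_norm_sq_circleMap hR hu
  have hA := norm_sq_circleMap_one_sub R (u / R)
  have hB := norm_sq_two_sub_circleMap_one_sub R (u / R)
  have hc : 0 ≤ 1 - Real.cos (u / R) := sub_nonneg.2 (Real.cos_le_one _)
  have hm0 : 0 < (1 + u ^ 2) / 5 := by positivity
  rw [norm_div, norm_pow, ← Complex.ofReal_neg, Complex.norm_cpow_real]
  refine rpow_neg_div_pow_le hm0 ?_ hm ?_ ?_ hpq
  · exact (norm_nonneg _).lt_of_ne' fun h => by rw [h] at hm; norm_num at hm; linarith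
  · refine le_of_sq_le_sq ?_ (norm_nonneg _)
    rw [hA, hB]
    nlinarith
  · refine le_of_sq_le_sq ?_ (by positivity)
    rw [mul_pow, hA, hB]
    nlinarith [mul_nonneg (mul_nonneg (by linarith : 0 ≤ R) (by linarith : 0 ≤ R - 2)) hc]

theorem tendsto_circleMap_one_sub (u : ℝ) :
    Filter.Tendsto (fun R : ℝ => circleMap (1 - R) R (u / R)) Filter.atTop
      (nhds (1 + I * u)) := by
  have hd : HasDerivAt (fun x : ℝ => Complex.exp (x * (u * I))) (u * I) 0 := by
    have := ((hasDerivAt_id (0 : ℝ)).ofReal_comp.mul_const (u * I : ℂ)).cexp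
    simpa using this
  have h := (hd.hasFDerivAt.lim_real 1).const_add (1 : ℂ)
  convert h using 1
  · ext R
    simp [circleMap]
    ring_nf
  · simp [mul_comm]

theorem integrable_one_add_sq_div_five_rpow {s : ℝ} (hs : 1 < s) :
    Integrable fun u : ℝ => ((1 + u ^ 2) / 5) ^ (-s / 2) := by
  have h := (integrable_rpow_neg_one_add_norm_sq (E := ℝ) (μ := volume) (r := s)
    (by simpa using hs)).div_const (5 ^ (-s / 2))
  refine h.congr (Filter.Eventually.of_forall fun u => ?_)
  simp only [Real.norm_eq_abs, sq_abs]
  rw [Real.div_rpow (by positivity) (by norm_num)]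

theorem integral_arcLength_circleMap_one_sub (t q : ℝ) (n : ℕ) {R : ℝ} (hR : 2 ≤ R) :
    ∫ u in (-(π * R))..(π * R), Complex.exp ((u / R : ℝ) * I) *
      (Complex.exp (t * circleMap (1 - R) R (u / R)) *
        ((2 - circleMap (1 - R) R (u / R)) ^ (-(q : ℂ)) /
          circleMap (1 - R) R (u / R) ^ (n + 1))) =
      2 * π * (iteratedDeriv n (fun z : ℂ => Complex.exp (t * z) * (2 - z) ^ (-(q : ℂ))) 0 /
        (n ! : ℂ)) := by
  have hR0 : 0 < R := by linarith
  have hball : Metric.closedBall (1 - R : ℂ) R ⊆ {z : ℂ | z.re < (2 : ℂ).re} := fun z hz => by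
    have h1 := (Complex.abs_re_le_norm (z - (1 - R))).trans (mem_closedBall_iff_norm.1 hz)
    have h2 := (le_abs_self _).trans h1
    simp only [Complex.sub_re, Complex.one_re, Complex.ofReal_re] at h2
    simp only [Set.mem_ofPred_eq, Complex.re_ofNat]
    linarith
  have h0 : (0 : ℂ) ∈ Metric.ball (1 - R : ℂ) R := by
    rw [mem_ball_iff_norm, zero_sub, norm_neg, ← Complex.ofReal_one, ← Complex.ofReal_sub,
      Complex.norm_real, Real.norm_eq_abs, abs_lt]
    constructor <;> linarith
  have h := circleIntegral_div_sub_pow_succ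
    (isOpen_lt Complex.continuous_re continuous_const) hball h0 n
    (differentiableOn_exp_mul_const_sub_cpow t 2 (-(q : ℂ)))
  rw [circleIntegral_eq_I_mul_integral_arcLength _ _ hR0] at h
  simp only [sub_zero, mul_div_assoc] at h ⊢
  apply mul_left_cancel₀ Complex.I_ne_zero
  rw [h]
  ring

theorem integral_exp_mul_cpow_div_pow (t q : ℝ) (n : ℕ) (ht : 0 ≤ t) (hq : 1 < (n + 1 : ℕ) + q) :
    ∫ u : ℝ, Complex.exp (t * (1 + I * u)) *
      ((2 - (1 + I * u)) ^ (-(q : ℂ)) / (1 + I * u) ^ (n + 1)) =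
      2 * π * (iteratedDeriv n (fun z : ℂ => Complex.exp (t * z) * (2 - z) ^ (-(q : ℂ))) 0 /
        (n ! : ℂ)) := by
  set W : ℝ → ℝ → ℂ := fun R u => circleMap (1 - R) R (u / R) with hW
  set G : ℝ → ℝ → ℂ := fun R u => Complex.exp ((u / R : ℝ) * I) *
    (Complex.exp (t * W R u) * ((2 - W R u) ^ (-(q : ℂ)) / W R u ^ (n + 1))) with hG
  have hG_int : ∀ R : ℝ, 2 ≤ R →
      ∫ u, (Set.Ioc (-(π * R)) (π * R)).indicator (G R) u =
        2 * π * (iteratedDeriv n (fun z : ℂ => Complex.exp (t * z) * (2 - z) ^ (-(q : ℂ))) 0 /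
          (n ! : ℂ)) := fun R hR => by
    rw [integral_indicator measurableSet_Ioc, ← intervalIntegral.integral_of_le]
    · exact integral_arcLength_circleMap_one_sub t q n hR
    · nlinarith [Real.pi_pos]
  have hG_meas : ∀ R, Measurable (G R) := fun R => by
    have : Measurable (W R) :=
      (continuous_circleMap _ _).measurable.comp (measurable_id.div_const R)
    fun_prop
  have hG_bound : ∀ R : ℝ, 2 ≤ R → ∀ u,
      ‖(Set.Ioc (-(π * R)) (π * R)).indicator (G R) u‖ ≤
        Real.exp t * (3 ^ |q| * ((1 + u ^ 2) / 5) ^ (-((n + 1 : ℕ) + q) / 2)) := fun R hR u => by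
    by_cases hu : u ∈ Set.Ioc (-(π * R)) (π * R)
    · rw [Set.indicator_of_mem hu, norm_mul, norm_mul, Complex.norm_exp_ofReal_mul_I, one_mul]
      refine mul_le_mul ?_ ?_ (norm_nonneg _) (Real.exp_pos t).le
      · rw [Complex.norm_exp, Complex.re_ofReal_mul]
        exact Real.exp_le_exp.2 <|
          mul_le_of_le_one_right ht (re_circleMap_one_sub_le (by linarith) _)
      · exact norm_two_sub_cpow_div_pow_circleMap_le hR (abs_le.2 ⟨hu.1.le, hu.2⟩) (by linarith)
    · rw [Set.indicator_of_notMem hu, norm_zero]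
      positivity
  have hG_lim : ∀ u : ℝ, Filter.Tendsto
      (fun R => (Set.Ioc (-(π * R)) (π * R)).indicator (G R) u) Filter.atTop
      (nhds (Complex.exp (t * (1 + I * u)) *
        ((2 - (1 + I * u)) ^ (-(q : ℂ)) / (1 + I * u) ^ (n + 1)))) := fun u => by
    have hWu := tendsto_circleMap_one_sub u
    have hne : (1 + I * u : ℂ) ≠ 0 := fun h => by simpa using congrArg Complex.re h
    have hsl : 2 - (1 + I * u : ℂ) ∈ Complex.slitPlane := Or.inl (by norm_num)
    have he : Filter.Tendsto (fun R : ℝ => Complex.exp ((u / R : ℝ) * I)) Filter.atTop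
        (nhds 1) := by
      have h1 : Filter.Tendsto (fun R : ℝ => u / R) Filter.atTop (nhds 0) :=
        Filter.tendsto_id.const_div_atTop u
      have h2 : Continuous fun x : ℝ => Complex.exp (x * I) := by fun_prop
      have h3 := (h2.tendsto 0).comp h1
      simp only [Complex.ofReal_zero, zero_mul, Complex.exp_zero] at h3
      exact h3
    have hlim := he.mul ((hWu.const_mul (t : ℂ)).cexp.mul
      ((Filter.Tendsto.cpow (hWu.const_sub 2) (tendsto_const_nhds (x := -(q : ℂ))) hsl).div
        (hWu.pow (n + 1)) (pow_ne_zero _ hne)))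
    rw [one_mul] at hlim
    refine hlim.congr' ?_
    filter_upwards [Filter.eventually_gt_atTop |u|] with R hR
    have hu := abs_lt.1 hR
    have : R ≤ π * R := le_mul_of_one_le_left ((abs_nonneg u).trans hR.le)
      (by linarith [Real.pi_gt_three])
    rw [Set.indicator_of_mem (Set.mem_Ioc.2 ⟨by linarith, by linarith⟩)]
    rfl
  have hlim := tendsto_integral_filter_of_dominated_convergence (μ := volume) (l := Filter.atTop)
    _ (Filter.Eventually.of_forall fun R =>
      ((hG_meas R).indicator measurableSet_Ioc).aestronglyMeasurable)
    ((Filter.eventually_ge_atTop 2).mono fun R hR => Filter.Eventually.of_forall (hG_bound R hR))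
    (((integrable_one_add_sq_div_five_rpow hq).const_mul _).const_mul _)
    (Filter.Eventually.of_forall hG_lim)
  refine tendsto_nhds_unique hlim (tendsto_const_nhds.congr' ?_)
  filter_upwards [Filter.eventually_ge_atTop 2] with R hR
  exact (hG_int R hR).symm

/-- For a positive integer `p`, a real `q` with `p + q > 1` and `t > 0`,
`(1/2π) ∫ e^{itω} (1+iω)^{-p} (1-iω)^{-q} dω
  = 2^{1-(p+q)} e^{-t} Σ_{k=0}^{p-1} (-1)^{p-1-k} C(-q, p-1-k) (2t)^k / k!`. -/
theorem inverse_fourier_principal_powers (p : ℕ) (hp : 0 < p) (q t : ℝ)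
    (hpq : 1 < (p : ℝ) + q) (ht : 0 < t) :
    (1 / (2 * Real.pi) : ℝ) *
        ∫ ω : ℝ, Complex.exp (Complex.I * (t : ℂ) * (ω : ℂ)) *
          (1 + Complex.I * (ω : ℂ)) ^ (-(p : ℂ)) *
          (1 - Complex.I * (ω : ℂ)) ^ (-(q : ℂ)) =
      (((2 : ℝ) ^ (1 - ((p : ℝ) + q)) : ℝ) : ℂ) * Complex.exp (-(t : ℂ)) *
        ∑ k ∈ Finset.range p,
          (-1 : ℂ) ^ (p - 1 - k) * (genBinom (-q) (p - 1 - k) : ℂ) *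
            ((2 * t : ℝ) : ℂ) ^ k / (k ! : ℂ) := by
  obtain ⟨n, rfl⟩ := Nat.exists_eq_succ_of_ne_zero hp.ne'
  have hmain := integral_exp_mul_cpow_div_pow t q n ht.le hpq
  have hintegrand : ∀ ω : ℝ, Complex.exp (I * (t : ℂ) * (ω : ℂ)) *
      (1 + I * (ω : ℂ)) ^ (-((n.succ : ℕ) : ℂ)) * (1 - I * (ω : ℂ)) ^ (-(q : ℂ)) =
      Complex.exp (-(t : ℂ)) * (Complex.exp (t * (1 + I * ω)) *
        ((2 - (1 + I * ω)) ^ (-(q : ℂ)) / (1 + I * ω) ^ (n + 1))) := fun ω => by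
    rw [← mul_assoc, ← Complex.exp_add, Complex.cpow_neg, Complex.cpow_natCast, Nat.succ_eq_add_one,
      show -(t : ℂ) + t * (1 + I * ω) = I * t * ω by ring,
      show (2 : ℂ) - (1 + I * ω) = 1 - I * ω by ring]
    simp only [div_eq_mul_inv]
    ac_rfl
  simp only [hintegrand]
  rw [integral_const_mul, hmain, iteratedDeriv_exp_mul_const_sub_cpow _ _ _ _ (by norm_num)]
  have hpi : (π : ℂ) ≠ 0 := by exact_mod_cast Real.pi_ne_zero
  have hcancel : ∀ E S : ℂ, ((1 / (2 * π) : ℝ) : ℂ) * (E * (2 * π * S)) = E * S := fun E S => by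
    push_cast
    field_simp
  rw [hcancel, mul_right_comm, mul_comm, Finset.mul_sum]
  congr 1
  refine Finset.sum_congr rfl fun k hk => ?_
  have hk' : k ≤ n := by simpa [Nat.lt_succ_iff] using hk
  have hpow : (2 : ℂ) ^ (-(q : ℂ) - (n - k : ℕ)) =
      (((2 : ℝ) ^ (1 - ((n.succ : ℕ) + q)) : ℝ) : ℂ) * 2 ^ k := by
    rw [← Complex.ofReal_ofNat 2, ← Complex.ofReal_pow, ← Complex.ofReal_mul,
      ← Real.rpow_natCast, ← Real.rpow_add two_pos, Complex.ofReal_cpow zero_le_two]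
    push_cast [Nat.cast_sub hk']
    congr 1
    ring
  rw [hpow, genBinom, show n.succ - 1 - k = n - k by omega]
  push_cast
  ring
end

section
/- Let α ≥ 1 be an integer and let p, q be positive integers with p + q = α + 1. Then for every t > 0, (1/2π) ∫_ℝ e^{itω} (1+iω)^{-p} (1-iω)^{-q} dω = 2^{-α} e^{-t} Σ_{k=0}^{p-1} C(α-1-k, p-1-k) (2t)^k / k!, and for every t < 0 the same integral equals 2^{-α} e^{t} Σ_{k=0}^{q-1} C(α-1-k, q-1-k) (-2t)^k / k!. (These are, up to the factor 1/√π, the 'two-sided' warped basis functions γ_n with |n| < (α+1)/2, where p = (α+1)/2 + n and q = (α+1)/2 - n.) -/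
open Complex Real MeasureTheory Nat

open scoped FourierTransform

/-- The Chaundy–Bullard identity. -/
theorem chaundy_bullard {R : Type*} [CommRing R] {x y : R} (h : x + y = 1) (m n : ℕ) :
    y ^ (n + 1) * ∑ j ∈ Finset.range (m + 1), ((n + j).choose j : R) * x ^ j +
      x ^ (m + 1) * ∑ j ∈ Finset.range (n + 1), ((m + j).choose j : R) * y ^ j = 1 := by
  obtain rfl : x = 1 - y := eq_sub_of_add_eq h
  have step (m n : ℕ) :
      (1 - y) * ∑ j ∈ Finset.range (n + 1), ((m + 1 + j).choose j : R) * y ^ j =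
        ∑ j ∈ Finset.range (n + 1), ((m + j).choose j : R) * y ^ j -
          ((n + m + 1).choose (m + 1) : R) * y ^ (n + 1) := by
    induction n with
    | zero => simp
    | succ n ih =>
      rw [Finset.sum_range_succ, mul_add, ih, Finset.sum_range_succ _ (n + 1)]
      have h₁ : (m + 1 + (n + 1)).choose (n + 1) = (n + 1 + m + 1).choose (m + 1) := by
        rw [show m + 1 + (n + 1) = n + 1 + (m + 1) by ring, Nat.choose_symm_add]
        rfl
      have h₂ : (n + 1 + m + 1).choose (m + 1) =
          (m + (n + 1)).choose (n + 1) + (n + m + 1).choose (m + 1) := by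
        rw [Nat.choose_succ_succ, ← Nat.choose_symm_add, show m + (n + 1) = n + 1 + m by ring,
          show n + m + 1 = n + 1 + m by ring]
      rw [h₁, h₂]
      push_cast
      ring
  induction m with
  | zero =>
    have hg := mul_neg_geom_sum y (n + 1)
    simp [hg]
  | succ m ih =>
    rw [Finset.sum_range_succ, pow_succ (1 - y) (m + 1), mul_assoc _ (1 - y), step]
    have h₃ : (n + (m + 1)).choose (m + 1) = (n + m + 1).choose (m + 1) := rfl
    rw [h₃]
    linear_combination ih

/-- Partial fraction expansion of `a⁻ᵖ b⁻ᑫ` when `a + b = 2`. -/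
theorem inv_pow_mul_inv_pow_eq_sum {a b : ℂ} (ha : a ≠ 0) (hb : b ≠ 0) (h : a + b = 2)
    {α p q : ℕ} (hp : 0 < p) (hq : 0 < q) (hpq : p + q = α + 1) :
    (a ^ p)⁻¹ * (b ^ q)⁻¹ =
      ∑ k ∈ Finset.range p,
          ((2 : ℂ) ^ α)⁻¹ * 2 ^ k * ((α - 1 - k).choose (p - 1 - k) : ℂ) * (a ^ (k + 1))⁻¹ +
        ∑ k ∈ Finset.range q,
          ((2 : ℂ) ^ α)⁻¹ * 2 ^ k * ((α - 1 - k).choose (q - 1 - k) : ℂ) * (b ^ (k + 1))⁻¹ := by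
  obtain ⟨m, rfl⟩ := Nat.exists_eq_add_of_lt hp
  obtain ⟨n, rfl⟩ := Nat.exists_eq_add_of_lt hq
  obtain rfl : α = m + n + 1 := by omega
  simp only [zero_add]
  have key := chaundy_bullard (x := a / 2) (y := b / 2) (by rw [← add_div, h]; simp) m n
  have side {a b : ℂ} (ha : a ≠ 0) (hb : b ≠ 0) (m n : ℕ) :
      ∑ k ∈ Finset.range (m + 1), ((2 : ℂ) ^ (m + n + 1))⁻¹ * 2 ^ k *
          ((m + n + 1 - 1 - k).choose (m + 1 - 1 - k) : ℂ) * (a ^ (k + 1))⁻¹ =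
        (a ^ (m + 1))⁻¹ * (b ^ (n + 1))⁻¹ * ((b / 2) ^ (n + 1) *
          ∑ j ∈ Finset.range (m + 1), ((n + j).choose j : ℂ) * (a / 2) ^ j) := by
    rw [← Finset.sum_range_reflect, Finset.mul_sum, Finset.mul_sum]
    refine Finset.sum_congr rfl fun j hj => ?_
    obtain ⟨i, rfl⟩ := Nat.exists_eq_add_of_le (Nat.lt_succ_iff.mp (Finset.mem_range.mp hj))
    rw [show j + i + 1 - 1 - j = i by omega, show j + i + n + 1 - 1 - i = n + j by omega,
      show j + i + 1 - 1 - i = j by omega, div_pow, div_pow]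
    field_simp
    ring
  rw [side ha hb m n, show m + n + 1 = n + m + 1 by ring, side hb ha n m]
  linear_combination (-(a ^ (m + 1))⁻¹ * (b ^ (n + 1))⁻¹) * key

theorem norm_pow_mul_exp_neg_mul (z : ℂ) (k : ℕ) {t : ℝ} (ht : 0 < t) :
    ‖(t : ℂ) ^ k * Complex.exp (-z * t)‖ = t ^ k * Real.exp (-z.re * t) := by
  simp [Complex.norm_exp, abs_of_pos ht]

theorem integrableOn_pow_mul_cexp_neg_mul_Ioi {z : ℂ} (hz : 0 < z.re) (k : ℕ) :
    IntegrableOn (fun t : ℝ => (t : ℂ) ^ k * Complex.exp (-z * t)) (Set.Ioi 0) := by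
  have hr := integrableOn_rpow_mul_exp_neg_mul_rpow (s := k) (p := 1) (b := z.re)
    (by have : (0 : ℝ) ≤ k := k.cast_nonneg
        linarith) one_pos hz
  refine hr.mono' (by fun_prop) ?_
  filter_upwards [ae_restrict_mem measurableSet_Ioi] with t ht
  rw [norm_pow_mul_exp_neg_mul z k ht, Real.rpow_natCast, Real.rpow_one]

theorem integral_pow_mul_cexp_neg_mul_Ioi {z : ℂ} (hz : 0 < z.re) (k : ℕ) :
    ∫ t in Set.Ioi (0 : ℝ), (t : ℂ) ^ k * Complex.exp (-z * t) = (k ! : ℂ) * (z ^ (k + 1))⁻¹ := by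
  have hz0 : z ≠ 0 := fun h => by simp [h] at hz
  have hd (n : ℕ) (t : ℝ) : HasDerivAt (fun t : ℝ => (t : ℂ) ^ n * Complex.exp (-z * t))
      (n * ((t : ℂ) ^ (n - 1) * Complex.exp (-z * t)) -
        z * ((t : ℂ) ^ n * Complex.exp (-z * t))) t := by
    have h₁ : HasDerivAt (fun t : ℂ => t ^ n * Complex.exp (-z * t))
      (n * (t : ℂ) ^ (n - 1) * Complex.exp (-z * t) +
        (t : ℂ) ^ n * (Complex.exp (-z * t) * (-z * 1))) (t : ℂ) :=
      (hasDerivAt_pow n (t : ℂ)).mul (((hasDerivAt_id (t : ℂ)).const_mul (-z)).cexp)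
    convert h₁.comp_ofReal using 1
    ring
  have hlim (n : ℕ) : Filter.Tendsto (fun t : ℝ => (t : ℂ) ^ n * Complex.exp (-z * t))
      Filter.atTop (nhds 0) := by
    rw [tendsto_zero_iff_norm_tendsto_zero]
    have := tendsto_rpow_mul_exp_neg_mul_atTop_nhds_zero n z.re hz
    refine this.congr' ?_
    filter_upwards [Filter.eventually_gt_atTop 0] with t ht
    rw [norm_pow_mul_exp_neg_mul z n ht, Real.rpow_natCast]
  have hint := integrableOn_pow_mul_cexp_neg_mul_Ioi hz
  have hftc (n : ℕ) := integral_Ioi_of_hasDerivAt_of_tendsto' (a := 0) (fun t _ => hd n t)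
    (((hint (n - 1)).const_mul (n : ℂ)).sub ((hint n).const_mul z)) (hlim n)
  have hrec (n : ℕ) := integral_sub ((hint (n - 1)).const_mul (n : ℂ)) ((hint n).const_mul z)
  simp only [integral_const_mul] at hrec
  induction k with
  | zero =>
    have := (hrec 0).symm.trans (hftc 0)
    simp only [Nat.cast_zero, zero_mul, zero_sub, pow_zero, one_mul, Complex.ofReal_zero, mul_zero,
      Complex.exp_zero, neg_inj] at this
    simp only [pow_zero, one_mul, Nat.factorial_zero, Nat.cast_one, zero_add, pow_one]
    exact eq_inv_of_mul_eq_one_right this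
  | succ k ih =>
    have := (hrec (k + 1)).symm.trans (hftc (k + 1))
    rw [Nat.add_sub_cancel, ih] at this
    simp only [Complex.ofReal_zero, ne_eq, Nat.succ_ne_zero, not_false_eq_true, zero_pow, zero_mul,
      sub_zero] at this
    have h2 := sub_eq_zero.mp this
    rw [← mul_right_inj' hz0, ← h2, Nat.factorial_succ]
    push_cast
    field_simp
    ring

/-- The density of the Gamma distribution with shape `k + 1` and rate `1`, valued in `ℂ`. -/
noncomputable def gammaDensity (k : ℕ) : ℝ → ℂ :=
  Set.indicator (Set.Ioi 0) fun t => (k ! : ℂ)⁻¹ * ((t : ℂ) ^ k * Complex.exp (-t))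

theorem gammaDensity_of_pos (k : ℕ) {t : ℝ} (ht : 0 < t) :
    gammaDensity k t = (k ! : ℂ)⁻¹ * ((t : ℂ) ^ k * Complex.exp (-t)) :=
  Set.indicator_of_mem (Set.mem_Ioi.mpr ht) _

theorem gammaDensity_of_nonpos (k : ℕ) {t : ℝ} (ht : t ≤ 0) : gammaDensity k t = 0 :=
  Set.indicator_of_notMem (by simpa using ht) _


theorem integrable_gammaDensity (k : ℕ) : Integrable (gammaDensity k) := by
  refine IntegrableOn.integrable_indicator ?_ measurableSet_Ioi
  have h := integrableOn_pow_mul_cexp_neg_mul_Ioi (z := 1) (by simp) k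
  simp only [neg_mul, one_mul] at h
  exact h.const_mul _

theorem fourier_gammaDensity (k : ℕ) (w : ℝ) :
    𝓕 (gammaDensity k) w = ((1 + Complex.I * (2 * Real.pi * w : ℝ)) ^ (k + 1))⁻¹ := by
  have hk : (k ! : ℂ) ≠ 0 := by exact_mod_cast k.factorial_ne_zero
  rw [Real.fourier_real_eq_integral_exp_smul]
  have h₁ (t : ℝ) : Complex.exp ((-2 * Real.pi * t * w : ℝ) * Complex.I) • gammaDensity k t =
      Set.indicator (Set.Ioi 0) (fun t : ℝ => (k ! : ℂ)⁻¹ * ((t : ℂ) ^ k *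
        Complex.exp (-(1 + Complex.I * (2 * Real.pi * w : ℝ)) * t))) t := by
    by_cases ht : t ∈ Set.Ioi 0
    · rw [gammaDensity, Set.indicator_of_mem ht, Set.indicator_of_mem ht, smul_eq_mul,
        mul_left_comm, mul_left_comm (Complex.exp _), ← Complex.exp_add]
      push_cast
      ring_nf
    · simp [gammaDensity, Set.indicator_of_notMem ht]
  simp_rw [h₁]
  rw [integral_indicator measurableSet_Ioi, integral_const_mul,
    integral_pow_mul_cexp_neg_mul_Ioi (by simp), inv_mul_cancel_left₀ hk]

theorem fourier_gammaDensity_neg (k : ℕ) (w : ℝ) :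
    𝓕 (fun t => gammaDensity k (-t)) w =
      ((1 - Complex.I * (2 * Real.pi * w : ℝ)) ^ (k + 1))⁻¹ := by
  have h : 𝓕 (fun t => gammaDensity k (-t)) w = 𝓕 (gammaDensity k) (-w) := by
    rw [Real.fourier_real_eq_integral_exp_smul, Real.fourier_real_eq_integral_exp_smul,
      ← integral_neg_eq_self]
    simp
  rw [h, fourier_gammaDensity]
  push_cast
  ring_nf

theorem continuousAt_gammaDensity (k : ℕ) {t : ℝ} (ht : t ≠ 0) :
    ContinuousAt (gammaDensity k) t := by
  rcases lt_or_gt_of_ne ht with h | h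
  · refine ContinuousAt.congr (f := fun _ : ℝ => (0 : ℂ)) continuousAt_const ?_
    filter_upwards [Iio_mem_nhds h] with s hs
    exact (gammaDensity_of_nonpos k (le_of_lt hs)).symm
  · refine ContinuousAt.congr (f := fun t : ℝ => (k ! : ℂ)⁻¹ * ((t : ℂ) ^ k * Complex.exp (-t)))
      (by fun_prop) ?_
    filter_upwards [Ioi_mem_nhds h] with s hs
    exact (gammaDensity_of_pos k hs).symm

theorem one_add_I_mul_ne_zero (x : ℝ) : 1 + Complex.I * (x : ℂ) ≠ 0 := fun h => by
  simpa using congrArg Complex.re h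

theorem one_sub_I_mul_ne_zero (x : ℝ) : 1 - Complex.I * (x : ℂ) ≠ 0 := fun h => by
  simpa using congrArg Complex.re h

theorem integrable_inv_pow_mul_inv_pow {p q : ℕ} (hp : 0 < p) (hq : 0 < q) :
    Integrable fun x : ℝ =>
      ((1 + Complex.I * (x : ℂ)) ^ p)⁻¹ * ((1 - Complex.I * (x : ℂ)) ^ q)⁻¹ := by
  have hcont : Continuous fun x : ℝ =>
      ((1 + Complex.I * (x : ℂ)) ^ p)⁻¹ * ((1 - Complex.I * (x : ℂ)) ^ q)⁻¹ :=
    (Continuous.inv₀ (by fun_prop) fun x => pow_ne_zero _ (one_add_I_mul_ne_zero x)).mul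
      (Continuous.inv₀ (by fun_prop) fun x => pow_ne_zero _ (one_sub_I_mul_ne_zero x))
  refine integrable_inv_one_add_sq.mono' hcont.aestronglyMeasurable (.of_forall fun x => ?_)
  have h₁ : ‖(1 + Complex.I * (x : ℂ))⁻¹‖ ≤ 1 := by
    rw [norm_inv]
    refine inv_le_one_of_one_le₀ ?_
    simpa using Complex.abs_re_le_norm (1 + Complex.I * (x : ℂ))
  have h₂ : ‖(1 - Complex.I * (x : ℂ))⁻¹‖ ≤ 1 := by
    rw [norm_inv]
    refine inv_le_one_of_one_le₀ ?_
    simpa using Complex.abs_re_le_norm (1 - Complex.I * (x : ℂ))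
  have h₃ : (1 + Complex.I * (x : ℂ)) * (1 - Complex.I * (x : ℂ)) = ((1 + x ^ 2 : ℝ) : ℂ) := by
    push_cast
    linear_combination (-(x : ℂ) ^ 2) * Complex.I_sq
  calc _ = ‖(1 + Complex.I * (x : ℂ))⁻¹‖ ^ p * ‖(1 - Complex.I * (x : ℂ))⁻¹‖ ^ q := by simp
    _ ≤ ‖(1 + Complex.I * (x : ℂ))⁻¹‖ * ‖(1 - Complex.I * (x : ℂ))⁻¹‖ := by
      gcongr
      · exact pow_le_of_le_one (norm_nonneg _) h₁ hp.ne'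
      · exact pow_le_of_le_one (norm_nonneg _) h₂ hq.ne'
    _ = (1 + x ^ 2)⁻¹ := by
      rw [← norm_mul, ← mul_inv, h₃, norm_inv, Complex.norm_real,
        Real.norm_of_nonneg (by positivity)]

theorem fourier_add_apply {f g : ℝ → ℂ} (hf : Integrable f) (hg : Integrable g) (w : ℝ) :
    𝓕 (fun t => f t + g t) w = 𝓕 f w + 𝓕 g w := by
  simp only [Real.fourier_eq, smul_add]
  exact integral_add ((Real.fourierIntegral_convergent_iff w).2 hf)
    ((Real.fourierIntegral_convergent_iff w).2 hg)

theorem fourier_sum_const_mul_apply {ι : Type*} (s : Finset ι) (c : ι → ℂ) {f : ι → ℝ → ℂ}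
    (hf : ∀ i, Integrable (f i)) (w : ℝ) :
    𝓕 (fun t => ∑ i ∈ s, c i * f i t) w = ∑ i ∈ s, c i * 𝓕 (f i) w := by
  have h (z : Circle) (i : ι) (x : ℂ) : z • (c i * x) = c i * z • x := by
    simp only [Circle.smul_def, smul_eq_mul, mul_left_comm]
  simp only [Real.fourier_eq, Finset.smul_sum, h]
  rw [integral_finsetSum]
  · simp only [integral_const_mul]
  · exact fun i _ => ((Real.fourierIntegral_convergent_iff w).2 (hf i)).const_mul (c i)

theorem integral_cexp_mul_cpow_mul_cpow {α p q : ℕ} (hp : 0 < p) (hq : 0 < q)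
    (hpq : p + q = α + 1) {t : ℝ} (ht : t ≠ 0) :
    (1 / (2 * Real.pi) : ℝ) *
        ∫ ω : ℝ, Complex.exp (Complex.I * (t : ℂ) * (ω : ℂ)) *
          (1 + Complex.I * (ω : ℂ)) ^ (-(p : ℂ)) * (1 - Complex.I * (ω : ℂ)) ^ (-(q : ℂ)) =
      ∑ k ∈ Finset.range p,
          ((2 : ℂ) ^ α)⁻¹ * 2 ^ k * ((α - 1 - k).choose (p - 1 - k) : ℂ) * gammaDensity k t +
        ∑ k ∈ Finset.range q,
          ((2 : ℂ) ^ α)⁻¹ * 2 ^ k * ((α - 1 - k).choose (q - 1 - k) : ℂ) *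
            gammaDensity k (-t) := by
  set f : ℝ → ℂ := fun t => ∑ k ∈ Finset.range p,
          ((2 : ℂ) ^ α)⁻¹ * 2 ^ k * ((α - 1 - k).choose (p - 1 - k) : ℂ) * gammaDensity k t +
        ∑ k ∈ Finset.range q,
          ((2 : ℂ) ^ α)⁻¹ * 2 ^ k * ((α - 1 - k).choose (q - 1 - k) : ℂ) *
            gammaDensity k (-t) with hf_def
  have hneg (k : ℕ) : Integrable fun t => gammaDensity k (-t) :=
    (integrable_gammaDensity k).comp_neg
  have hi₁ := integrable_finsetSum (Finset.range p) fun k _ => (integrable_gammaDensity k).const_mul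
    (((2 : ℂ) ^ α)⁻¹ * 2 ^ k * ((α - 1 - k).choose (p - 1 - k) : ℂ))
  have hi₂ := integrable_finsetSum (Finset.range q) fun k _ => (hneg k).const_mul
    (((2 : ℂ) ^ α)⁻¹ * 2 ^ k * ((α - 1 - k).choose (q - 1 - k) : ℂ))
  have hf : Integrable f := hi₁.add hi₂
  have hfourier : 𝓕 f = fun w : ℝ => ((1 + Complex.I * (2 * Real.pi * w : ℝ)) ^ p)⁻¹ *
      ((1 - Complex.I * (2 * Real.pi * w : ℝ)) ^ q)⁻¹ := by
    funext w
    rw [inv_pow_mul_inv_pow_eq_sum (one_add_I_mul_ne_zero _) (one_sub_I_mul_ne_zero _) (by ring)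
      hp hq hpq, fourier_add_apply hi₁ hi₂, fourier_sum_const_mul_apply _ _ integrable_gammaDensity,
      fourier_sum_const_mul_apply _ _ hneg]
    simp only [fourier_gammaDensity, fourier_gammaDensity_neg]
  have hF : Integrable (𝓕 f) := by
    rw [hfourier]
    exact (integrable_inv_pow_mul_inv_pow hp hq).comp_mul_left' (by positivity)
  have hc : ContinuousAt f t := by
    refine ContinuousAt.add ?_ ?_
    · exact tendsto_finsetSum _ fun k _ => (continuousAt_gammaDensity k ht).const_mul _
    · refine tendsto_finsetSum _ fun k _ => Filter.Tendsto.const_mul _ ?_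
      exact (continuousAt_gammaDensity k (neg_ne_zero.mpr ht)).comp continuousAt_neg
  change _ = f t
  rw [← hf.fourierInv_fourier_eq hF hc, hfourier, Real.fourierInv_eq']
  have hsub := Measure.integral_comp_mul_left (fun ω : ℝ =>
    Complex.exp (Complex.I * (t : ℂ) * (ω : ℂ)) *
      (1 + Complex.I * (ω : ℂ)) ^ (-(p : ℂ)) * (1 - Complex.I * (ω : ℂ)) ^ (-(q : ℂ))) (2 * Real.pi)
  rw [abs_of_pos (by positivity), ← one_div, Complex.real_smul] at hsub
  rw [← hsub]
  congr 1 with w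
  simp only [Complex.cpow_neg, Complex.cpow_natCast, smul_eq_mul]
  rw [mul_assoc]
  congr 2
  simp
  ring

/-- For an integer `α ≥ 1` and positive integers `p`, `q` with `p + q = α + 1`, the
inverse Fourier transform `(1/2π)∫ e^{itω}(1+iω)^{-p}(1-iω)^{-q} dω` equals
`2^{-α} e^{-t} Σ_{k=0}^{p-1} C(α-1-k, p-1-k)(2t)^k/k!` for `t > 0`, and
`2^{-α} e^{t} Σ_{k=0}^{q-1} C(α-1-k, q-1-k)(-2t)^k/k!` for `t < 0`. -/
theorem two_sided_inverse_fourier (α p q : ℕ) (hα : 1 ≤ α) (hp : 0 < p) (hq : 0 < q)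
    (hpq : p + q = α + 1) :
    (∀ t : ℝ, 0 < t →
      (1 / (2 * Real.pi) : ℝ) *
          ∫ ω : ℝ, Complex.exp (Complex.I * (t : ℂ) * (ω : ℂ)) *
            (1 + Complex.I * (ω : ℂ)) ^ (-(p : ℂ)) *
            (1 - Complex.I * (ω : ℂ)) ^ (-(q : ℂ)) =
        ((2 : ℂ) ^ α)⁻¹ * Complex.exp (-(t : ℂ)) *
          ∑ k ∈ Finset.range p,
            (((α - 1 - k).choose (p - 1 - k) : ℝ) : ℂ) * ((2 * t : ℝ) : ℂ) ^ k / (k ! : ℂ)) ∧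
    (∀ t : ℝ, t < 0 →
      (1 / (2 * Real.pi) : ℝ) *
          ∫ ω : ℝ, Complex.exp (Complex.I * (t : ℂ) * (ω : ℂ)) *
            (1 + Complex.I * (ω : ℂ)) ^ (-(p : ℂ)) *
            (1 - Complex.I * (ω : ℂ)) ^ (-(q : ℂ)) =
        ((2 : ℂ) ^ α)⁻¹ * Complex.exp ((t : ℂ)) *
          ∑ k ∈ Finset.range q,
            (((α - 1 - k).choose (q - 1 - k) : ℝ) : ℂ) * ((-2 * t : ℝ) : ℂ) ^ k / (k ! : ℂ)) := by

  refine ⟨fun t ht => ?_, fun t ht => ?_⟩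
  · rw [integral_cexp_mul_cpow_mul_cpow hp hq hpq ht.ne', Finset.mul_sum]
    simp only [gammaDensity_of_pos _ ht, gammaDensity_of_nonpos _ (neg_nonpos.mpr ht.le), mul_zero,
      Finset.sum_const_zero, add_zero]
    refine Finset.sum_congr rfl fun k _ => ?_
    push_cast
    ring
  · rw [integral_cexp_mul_cpow_mul_cpow hp hq hpq ht.ne, Finset.mul_sum]
    simp only [gammaDensity_of_pos _ (neg_pos.mpr ht), gammaDensity_of_nonpos _ ht.le, mul_zero,
      Finset.sum_const_zero, zero_add]
    refine Finset.sum_congr rfl fun k _ => ?_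
    push_cast
    rw [neg_neg, show (-2 : ℂ) * t = 2 * -t by ring, mul_pow]
    ring
end

section
/- Let β > 1/2, c₁ = (π/2)/∫_0^{∞}(1+v²)^{-β}dv, ψ(ω) = c₁∫_0^{ω}(1+v²)^{-β}dv, and let φ : (-π/2, π/2) → ℝ be the inverse of ψ. Then for every integer k ≥ 1, φ is k-times differentiable and there exists a nonzero real constant C_k such that (π/2 - u)^{1/(2β-1)+k} · φ^{(k)}(u) tends to C_k as u → (π/2)⁻. -/
open Real MeasureTheory Filter

/-- The polynomial factors of the derivatives of `φ` when `φ' = c⁻¹ (1 + φ²)^β`: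
`φ⁽ⁿ⁺¹⁾ = c⁻⁽ⁿ⁺¹⁾ Qₙ(φ) (1 + φ²)^((n + 1) β - n)`. -/
noncomputable def warpPoly (β : ℝ) : ℕ → Polynomial ℝ
  | 0 => 1
  | n + 1 => (1 + Polynomial.X ^ 2) * (warpPoly β n).derivative +
      Polynomial.C (2 * ((n + 1) * β - n)) * Polynomial.X * warpPoly β n

/-- The `(n + 1)`-st derivative of `φ` as a function of the value of `φ`. -/
noncomputable def warpDeriv (β c : ℝ) (n : ℕ) (ω : ℝ) : ℝ :=
  (c⁻¹) ^ (n + 1) * ((warpPoly β n).eval ω * (1 + ω ^ 2) ^ ((n + 1) * β - n))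

lemma natDegree_warpPoly_le (β : ℝ) (n : ℕ) : (warpPoly β n).natDegree ≤ n := by
  induction n with
  | zero => simp [warpPoly]
  | succ n ih =>
    rw [warpPoly]
    refine Polynomial.natDegree_add_le_of_degree_le ?_ ?_
    · rcases Nat.eq_zero_or_pos n with rfl | hn
      · simp [warpPoly]
      · have h1 : (1 + Polynomial.X ^ 2 : Polynomial ℝ).natDegree ≤ 2 := by compute_degree
        have h2 := Polynomial.natDegree_derivative_le (warpPoly β n)
        refine Polynomial.natDegree_mul_le.trans ?_
        omega
    · have h1 : (Polynomial.C (2 * ((n + 1) * β - n)) * Polynomial.X : Polynomial ℝ).natDegree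
          ≤ 1 := by compute_degree
      refine Polynomial.natDegree_mul_le.trans ?_
      omega

lemma coeff_warpPoly_succ (β : ℝ) (n : ℕ) :
    (warpPoly β (n + 1)).coeff (n + 1) =
      ((n + 1) * (2 * β - 1) + 1) * (warpPoly β n).coeff n := by
  have h0 : (warpPoly β n).derivative.coeff (n + 1) = 0 := by
    rw [Polynomial.coeff_derivative, Polynomial.coeff_eq_zero_of_natDegree_lt, zero_mul]
    have := natDegree_warpPoly_le β n
    omega
  have h1 : (Polynomial.X ^ 2 * (warpPoly β n).derivative).coeff (n + 1) =
      n * (warpPoly β n).coeff n := by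
    rcases n with _ | n
    · simp [warpPoly]
    · rw [Polynomial.coeff_X_pow_mul', if_pos (by omega), Polynomial.coeff_derivative]
      push_cast
      exact mul_comm _ _
  rw [warpPoly, Polynomial.coeff_add, add_mul, one_mul, Polynomial.coeff_add, h0, h1,
    mul_assoc, Polynomial.coeff_C_mul, Polynomial.coeff_X_mul]
  ring

lemma coeff_warpPoly_pos {β : ℝ} (hβ : 1 / 2 < β) (n : ℕ) : 0 < (warpPoly β n).coeff n := by
  induction n with
  | zero => simp [warpPoly]
  | succ n ih =>
    rw [coeff_warpPoly_succ]
    have : 0 < 2 * β - 1 := by linarith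
    positivity

lemma tendsto_eval_warpPoly_div_pow {β : ℝ} (hβ : 1 / 2 < β) (n : ℕ) :
    Tendsto (fun ω => (warpPoly β n).eval ω / ω ^ n) atTop (nhds ((warpPoly β n).coeff n)) := by
  have hdeg : (warpPoly β n).natDegree = n :=
    (natDegree_warpPoly_le β n).antisymm
      (Polynomial.le_natDegree_of_ne_zero (coeff_warpPoly_pos hβ n).ne')
  have hne : warpPoly β n ≠ 0 := by
    intro h
    simpa [h] using coeff_warpPoly_pos hβ n
  have h := Polynomial.div_tendsto_atTop_leadingCoeff_div_of_degree_eq (warpPoly β n)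
    (Polynomial.X ^ n) (by rw [Polynomial.degree_eq_natDegree hne, hdeg, Polynomial.degree_X_pow])
  simpa [Polynomial.leadingCoeff, hdeg] using h

lemma hasDerivAt_one_add_sq_rpow (p ω : ℝ) :
    HasDerivAt (fun x : ℝ => (1 + x ^ 2) ^ p) (2 * ω * p * (1 + ω ^ 2) ^ (p - 1)) ω := by
  have h : HasDerivAt (fun x : ℝ => 1 + x ^ 2) (2 * ω) ω := by
    simpa using (hasDerivAt_pow 2 ω).const_add 1
  exact h.rpow_const (Or.inl (by positivity))

lemma hasDerivAt_warpDeriv (β : ℝ) {c : ℝ} (hc : c ≠ 0) (n : ℕ) (ω : ℝ) :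
    HasDerivAt (warpDeriv β c n)
      (warpDeriv β c (n + 1) ω * (c * (1 + ω ^ 2) ^ (-β))) ω := by
  have h := (((warpPoly β n).hasDerivAt ω).mul
    (hasDerivAt_one_add_sq_rpow ((n + 1) * β - n) ω)).const_mul ((c⁻¹) ^ (n + 1))
  refine h.congr_deriv ?_
  have hpos : (0 : ℝ) < 1 + ω ^ 2 := by positivity
  have h1 : (1 + ω ^ 2) ^ ((n + 1) * β - n) =
      (1 + ω ^ 2) ^ ((n + 1) * β - n - 1) * (1 + ω ^ 2) := by
    rw [Real.rpow_sub_one hpos.ne', div_mul_cancel₀ _ hpos.ne']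
  have h2 : (1 + ω ^ 2) ^ (((n + 1 : ℕ) + 1) * β - (n + 1 : ℕ)) * (1 + ω ^ 2) ^ (-β) =
      (1 + ω ^ 2) ^ ((n + 1) * β - n - 1) := by
    rw [← Real.rpow_add hpos]
    congr 1
    push_cast
    ring
  have h3 : (c⁻¹) ^ (n + 1 + 1) * c = (c⁻¹) ^ (n + 1) := by
    rw [pow_succ, mul_assoc, inv_mul_cancel₀ hc, mul_one]
  calc _ = (c⁻¹) ^ (n + 1) * ((warpPoly β (n + 1)).eval ω *
        (1 + ω ^ 2) ^ ((n + 1) * β - n - 1)) := by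
        rw [h1, warpPoly]
        simp only [Polynomial.eval_add, Polynomial.eval_mul, Polynomial.eval_one,
          Polynomial.eval_pow, Polynomial.eval_X, Polynomial.eval_C]
        ring
    _ = _ := by
        rw [← h2, ← h3, warpDeriv]
        ring

/-- The function `v ↦ (1 + v²)^(-β)` is integrable for `β > 1/2`. -/
lemma integrable_one_add_sq_rpow_neg {β : ℝ} (hβ : 1 / 2 < β) :
    Integrable (fun v : ℝ => (1 + v ^ 2) ^ (-β)) := by
  have h := integrable_rpow_neg_one_add_norm_sq (E := ℝ) (μ := volume) (r := 2 * β)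
    (by simp; linarith)
  refine h.congr (ae_of_all _ fun v => ?_)
  simp only [Real.norm_eq_abs, sq_abs]
  congr 1
  ring

lemma integral_Ioi_one_add_sq_rpow_neg_pos {β : ℝ} (hβ : 1 / 2 < β) :
    0 < ∫ v in Set.Ioi (0 : ℝ), (1 + v ^ 2) ^ (-β) := by
  rw [setIntegral_pos_iff_support_of_nonneg_ae
    (ae_of_all _ fun v => by simp only [Pi.zero_apply]; positivity)
    (integrable_one_add_sq_rpow_neg hβ).integrableOn]
  have : Function.support (fun v : ℝ => (1 + v ^ 2) ^ (-β)) = Set.univ :=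
    Set.eq_univ_of_forall fun v => by
      rw [Function.mem_support]
      positivity
  simp [this]

lemma tendsto_one_add_sq_div_sq : Tendsto (fun ω : ℝ => (1 + ω ^ 2) / ω ^ 2) atTop (nhds 1) := by
  have h : Tendsto (fun ω : ℝ => (ω ^ 2)⁻¹ + 1) atTop (nhds (0 + 1)) :=
    (tendsto_pow_atTop two_ne_zero).inv_tendsto_atTop.add_const 1
  rw [zero_add] at h
  refine h.congr' ?_
  filter_upwards [eventually_gt_atTop 0] with ω hω
  field_simp

lemma tendsto_one_add_sq_div_sq_rpow (p : ℝ) :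
    Tendsto (fun ω : ℝ => ((1 + ω ^ 2) / ω ^ 2) ^ p) atTop (nhds 1) := by
  simpa using tendsto_one_add_sq_div_sq.rpow_const (p := p) (Or.inl one_ne_zero)

/-- If `ψ' = c (1 + ω²)^(-β)` and `ψ → L` at infinity then
`L - ψ ω ∼ c ω^(-(2β - 1)) / (2β - 1)`. -/
lemma tendsto_sub_mul_rpow {β c L : ℝ} (hβ : 1 / 2 < β) {ψ : ℝ → ℝ}
    (hψ : ∀ ω, HasDerivAt ψ (c * (1 + ω ^ 2) ^ (-β)) ω) (hL : Tendsto ψ atTop (nhds L)) :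
    Tendsto (fun ω => (L - ψ ω) * ω ^ (2 * β - 1)) atTop (nhds (c / (2 * β - 1))) := by
  have hs : 0 < 2 * β - 1 := by linarith
  have hquot : Tendsto (fun ω => (L - ψ ω) / ω ^ (-(2 * β - 1))) atTop
      (nhds (c / (2 * β - 1))) := by
    refine HasDerivAt.lhopital_zero_atTop (f' := fun ω => -(c * (1 + ω ^ 2) ^ (-β)))
      (g' := fun ω => -(2 * β - 1) * ω ^ (-(2 * β - 1) - 1))
      (Eventually.of_forall fun ω => (hψ ω).const_sub L) ?_ ?_ ?_
      (tendsto_rpow_neg_atTop hs) ?_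
    · filter_upwards [eventually_gt_atTop 0] with ω hω
      exact Real.hasDerivAt_rpow_const (Or.inl hω.ne')
    · filter_upwards [eventually_gt_atTop 0] with ω hω
      exact mul_ne_zero (neg_ne_zero.2 hs.ne') (by positivity)
    · simpa using hL.const_sub L
    · have h := (tendsto_one_add_sq_div_sq_rpow (-β)).const_mul (c / (2 * β - 1))
      rw [mul_one] at h
      refine h.congr' ?_
      filter_upwards [eventually_gt_atTop 0] with ω hω
      have h2 : (ω ^ 2) ^ (-β) = ω ^ (-(2 * β - 1) - 1) := by
        rw [← Real.rpow_natCast, ← Real.rpow_mul hω.le]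
        congr 1
        push_cast
        ring
      rw [Real.div_rpow (by positivity) (by positivity), h2]
      have : ω ^ (-(2 * β - 1) - 1) ≠ 0 := by positivity
      field_simp
  refine hquot.congr' ?_
  filter_upwards [eventually_gt_atTop 0] with ω hω
  rw [Real.rpow_neg hω.le, div_inv_eq_mul]

lemma tendsto_rpow_mul_warpDeriv {β c L : ℝ} (hβ : 1 / 2 < β) (hc : 0 < c) {ψ : ℝ → ℝ}
    (hψ : ∀ ω, HasDerivAt ψ (c * (1 + ω ^ 2) ^ (-β)) ω) (hL : Tendsto ψ atTop (nhds L))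
    (hlt : ∀ ω, ψ ω < L) (n : ℕ) :
    Tendsto (fun ω => (L - ψ ω) ^ (1 / (2 * β - 1) + (n + 1 : ℕ)) * warpDeriv β c n ω) atTop
      (nhds ((c / (2 * β - 1)) ^ (1 / (2 * β - 1) + (n + 1 : ℕ)) *
        ((c⁻¹) ^ (n + 1) * (warpPoly β n).coeff n))) := by
  have hs : 0 < 2 * β - 1 := by linarith
  have h1 := (tendsto_sub_mul_rpow hβ hψ hL).rpow_const (p := 1 / (2 * β - 1) + (n + 1 : ℕ))
    (Or.inl (by positivity))
  have h2 := (tendsto_eval_warpPoly_div_pow hβ n).mul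
    (tendsto_one_add_sq_div_sq_rpow ((n + 1) * β - n))
  rw [mul_one] at h2
  refine (h1.mul (h2.const_mul ((c⁻¹) ^ (n + 1)))).congr' ?_
  filter_upwards [eventually_gt_atTop 0] with ω hω
  have hsub : 0 < L - ψ ω := sub_pos.2 (hlt ω)
  have hpow : (ω ^ (2 * β - 1)) ^ (1 / (2 * β - 1) + ((n + 1 : ℕ) : ℝ)) =
      ω ^ n * (ω ^ 2) ^ ((n + 1) * β - n) := by
    rw [← Real.rpow_natCast ω 2, ← Real.rpow_natCast ω n, ← Real.rpow_mul hω.le,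
      ← Real.rpow_mul hω.le, ← Real.rpow_add hω]
    congr 1
    push_cast
    field_simp
    ring
  rw [Real.mul_rpow hsub.le (by positivity), hpow,
    Real.div_rpow (by positivity) (by positivity), warpDeriv]
  field_simp

/-- A differentiable function with positive derivative and limits `a`, `b` at `∓∞` has range
`(a, b)`, and its inverse is differentiable there and tends to `∞` at `b`. -/
lemma hasDerivAt_leftInverse_of_tendsto {a b : ℝ} {ψ ψ' φ : ℝ → ℝ}
    (hψ : ∀ ω, HasDerivAt ψ (ψ' ω) ω) (hpos : ∀ ω, 0 < ψ' ω)
    (htop : Tendsto ψ atTop (nhds b)) (hbot : Tendsto ψ atBot (nhds a))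
    (hφ : ∀ ω, φ (ψ ω) = ω) :
    (∀ ω, ψ ω ∈ Set.Ioo a b) ∧ (∀ u ∈ Set.Ioo a b, ψ (φ u) = u) ∧
      (∀ u ∈ Set.Ioo a b, HasDerivAt φ (ψ' (φ u))⁻¹ u) ∧
      Tendsto φ (nhdsWithin b (Set.Ioo a b)) atTop := by
  have hmono : StrictMono ψ := strictMono_of_hasDerivAt_pos hψ hpos
  have hcont : Continuous ψ := continuous_iff_continuousAt.2 fun ω => (hψ ω).continuousAt
  have hmem : ∀ ω, ψ ω ∈ Set.Ioo a b := fun ω =>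
    ⟨(hmono.monotone.le_of_tendsto hbot (ω - 1)).trans_lt (hmono (by linarith)),
      (hmono (by linarith : ω < ω + 1)).trans_le (hmono.monotone.ge_of_tendsto htop (ω + 1))⟩
  have hinv : ∀ u ∈ Set.Ioo a b, ψ (φ u) = u := by
    intro u hu
    obtain ⟨ω, rfl⟩ := mem_range_of_exists_le_of_exists_ge hcont
      ((hbot.eventually (eventually_le_nhds hu.1)).exists)
      ((htop.eventually (eventually_ge_nhds hu.2)).exists)
    rw [hφ]
  have hφmono : StrictMonoOn φ (Set.Ioo a b) := by
    intro u hu v hv huv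
    rwa [← hmono.lt_iff_lt, hinv u hu, hinv v hv]
  refine ⟨hmem, hinv, fun u hu => ?_, ?_⟩
  · have himage : φ '' Set.Ioo a b = Set.univ :=
      Set.eq_univ_of_forall fun ω => ⟨ψ ω, hmem ω, hφ ω⟩
    have hnhds : Set.Ioo a b ∈ nhds u := Ioo_mem_nhds hu.1 hu.2
    refine HasDerivAt.of_local_left_inverse ?_ (hψ (φ u)) (hpos _).ne' ?_
    · exact hφmono.continuousAt_of_image_mem_nhds hnhds (by rw [himage]; exact univ_mem)
    · filter_upwards [hnhds] with v hv using hinv v hv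
  · refine tendsto_atTop.2 fun M => ?_
    filter_upwards [self_mem_nhdsWithin,
      mem_nhdsWithin_of_mem_nhds (Ioi_mem_nhds (hmem M).2)] with u hu hMu
    rw [← hmono.le_iff_le, hinv u hu]
    exact le_of_lt hMu

lemma iteratedDerivWithin_succ_eq_warpDeriv {β c a b : ℝ} (hc : 0 < c) {φ : ℝ → ℝ}
    (hφ : ∀ u ∈ Set.Ioo a b, HasDerivAt φ (c * (1 + φ u ^ 2) ^ (-β))⁻¹ u) (n : ℕ) :
    Set.EqOn (iteratedDerivWithin (n + 1) φ (Set.Ioo a b)) (fun u => warpDeriv β c n (φ u))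
      (Set.Ioo a b) ∧
    ∀ u ∈ Set.Ioo a b, HasDerivAt (fun u => warpDeriv β c n (φ u))
      (warpDeriv β c (n + 1) (φ u)) u := by
  have hderiv : ∀ n, ∀ u ∈ Set.Ioo a b, HasDerivAt (fun u => warpDeriv β c n (φ u))
      (warpDeriv β c (n + 1) (φ u)) u := by
    intro n u hu
    have hne : c * (1 + φ u ^ 2) ^ (-β) ≠ 0 := by positivity
    have h := (hasDerivAt_warpDeriv β hc.ne' n (φ u)).comp u (hφ u hu)
    rwa [mul_assoc, mul_inv_cancel₀ hne, mul_one] at h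
  refine ⟨?_, hderiv n⟩
  induction n with
  | zero =>
    intro u hu
    rw [zero_add, iteratedDerivWithin_one,
      (hφ u hu).hasDerivWithinAt.derivWithin (isOpen_Ioo.uniqueDiffWithinAt hu)]
    have : (0 : ℝ) < 1 + φ u ^ 2 := by positivity
    simp [warpDeriv, warpPoly, Real.rpow_neg this.le, mul_comm]
  | succ n ih =>
    intro u hu
    rw [iteratedDerivWithin_succ, derivWithin_congr ih (ih hu)]
    exact (hderiv n u hu).hasDerivWithinAt.derivWithin (isOpen_Ioo.uniqueDiffWithinAt hu)

/-- Asymptotics of the derivatives of the inverse warping function `φ = ψ⁻¹` on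
`(-π/2, π/2)`: for every `k ≥ 1`, `φ` is `k`-times differentiable and there is a nonzero
constant `C_k` with `(π/2 - u)^{1/(2β-1)+k} φ^{(k)}(u) → C_k` as `u → (π/2)⁻`. -/
theorem inverse_warping_derivative_asymptotics (β : ℝ) (hβ : 1 / 2 < β) (c₁ : ℝ)
    (hc₁ : c₁ = (Real.pi / 2) / ∫ v in Set.Ioi (0 : ℝ), (1 + v ^ 2) ^ (-β))
    (ψ : ℝ → ℝ)
    (hψ : ∀ ω : ℝ, ψ ω = c₁ * ∫ v in (0 : ℝ)..ω, (1 + v ^ 2) ^ (-β))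
    (φ : ℝ → ℝ) (hφ : ∀ ω : ℝ, φ (ψ ω) = ω) (k : ℕ) (hk : 1 ≤ k) :
    (∀ j < k, DifferentiableOn ℝ
        (iteratedDerivWithin j φ (Set.Ioo (-(Real.pi / 2)) (Real.pi / 2)))
        (Set.Ioo (-(Real.pi / 2)) (Real.pi / 2))) ∧
      ∃ C : ℝ, C ≠ 0 ∧
        Tendsto
          (fun u : ℝ => (Real.pi / 2 - u) ^ (1 / (2 * β - 1) + k) *
            iteratedDerivWithin k φ (Set.Ioo (-(Real.pi / 2)) (Real.pi / 2)) u)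
          (nhdsWithin (Real.pi / 2) (Set.Ioo (-(Real.pi / 2)) (Real.pi / 2)))
          (nhds C) := by
  set f : ℝ → ℝ := fun v => (1 + v ^ 2) ^ (-β) with hf
  have hfcont : Continuous f :=
    continuous_iff_continuousAt.2 fun v => (hasDerivAt_one_add_sq_rpow (-β) v).continuousAt
  have hI := integral_Ioi_one_add_sq_rpow_neg_pos hβ
  have hc : 0 < c₁ := hc₁ ▸ div_pos (by positivity) hI
  have hψ' : ∀ ω, HasDerivAt ψ (c₁ * (1 + ω ^ 2) ^ (-β)) ω := by
    intro ω
    rw [funext hψ]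
    exact (intervalIntegral.integral_hasDerivAt_right (hfcont.intervalIntegrable 0 ω)
      hfcont.aestronglyMeasurable.stronglyMeasurableAtFilter hfcont.continuousAt).const_mul c₁
  have htop : Tendsto ψ atTop (nhds (Real.pi / 2)) := by
    have h := (intervalIntegral_tendsto_integral_Ioi 0
      (integrable_one_add_sq_rpow_neg hβ).integrableOn tendsto_id).const_mul c₁
    rw [hc₁, div_mul_cancel₀ _ hI.ne', ← hc₁] at h
    exact h.congr fun ω => (hψ ω).symm
  have hodd : ∀ ω, ψ ω = -ψ (-ω) := by
    intro ω
    have h := intervalIntegral.integral_comp_neg (a := 0) (b := ω) f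
    simp only [hf, neg_sq, neg_zero] at h
    rw [hψ, hψ, h, intervalIntegral.integral_symm, mul_neg]
  have hbot : Tendsto ψ atBot (nhds (-(Real.pi / 2))) :=
    (htop.comp tendsto_neg_atBot_atTop).neg.congr fun ω => (hodd ω).symm
  obtain ⟨hmem, hinv, hφ', hφtop⟩ :=
    hasDerivAt_leftInverse_of_tendsto hψ' (fun ω => by positivity) htop hbot hφ
  have hiter := iteratedDerivWithin_succ_eq_warpDeriv hc hφ'
  refine ⟨fun j _ u hu => ?_, ?_⟩
  · rcases j with _ | j
    · rw [iteratedDerivWithin_zero]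
      exact (hφ' u hu).differentiableAt.differentiableWithinAt
    · exact ((hiter j).2 u hu).differentiableAt.differentiableWithinAt.congr
        (hiter j).1 ((hiter j).1 hu)
  · obtain ⟨n, rfl⟩ : ∃ n, k = n + 1 := ⟨k - 1, by omega⟩
    have hs : 0 < 2 * β - 1 := by linarith
    have hq := coeff_warpPoly_pos hβ n
    refine ⟨_, ?_, ((tendsto_rpow_mul_warpDeriv hβ hc hψ' htop (fun ω => (hmem ω).2) n).comp
      hφtop).congr' ?_⟩
    · positivity
    · filter_upwards [self_mem_nhdsWithin] with u hu
      rw [Function.comp_apply, hinv u hu, (hiter n).1 hu]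
end
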